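/- arXiv:1705.09904 — 6 statements merged into one kernel-verified Lean document; each statement's English description precedes it below -/
import Mathlib

section
/- For every τ in the complex upper half-plane ℍ and every z ∈ ℂ, the series defining θ₁ converges absolutely and equals i times an absolutely convergent infinite product: Σ_{n∈ℤ} (−1)^n q^{(n−1/2)²/2} y^{n−1/2} = q^{1/8} y^{−1/2} ∏_{n=1}^∞ (1−q^n)(1−q^{n−1}y)(1−q^n y^{−1}). -/
open Complex Real

/-- The summand of the series defining the Jacobi theta function `θ₁`:
`(-1)^n * q^((n-1/2)²/2) * y^(n-1/2)` where `q = exp(2πiτ)`, `y = exp(2πiz)`. -/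
noncomputable def theta1Term (τ z : ℂ) (n : ℤ) : ℂ :=
  (-1 : ℂ) ^ n * Complex.exp (π * I * ((n : ℂ) - 1/2)^2 * τ) *
    Complex.exp (2 * π * I * ((n : ℂ) - 1/2) * z)

/-- The `n`-th factor (for `n ≥ 1`, indexed by `n : ℕ` starting from `0`) of the triple
product: `(1-q^n)(1-q^(n-1)y)(1-q^n y⁻¹)`. -/
noncomputable def theta1ProdTerm (τ z : ℂ) (n : ℕ) : ℂ :=
  (1 - Complex.exp (2 * π * I * τ) ^ (n + 1)) *
  (1 - Complex.exp (2 * π * I * τ) ^ n * Complex.exp (2 * π * I * z)) *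
  (1 - Complex.exp (2 * π * I * τ) ^ (n + 1) * (Complex.exp (2 * π * I * z))⁻¹)

open Filter Topology Finset

/-- The finite `q`-Pochhammer symbol `(q; q)_n = ∏_{j=1}^n (1 - q^j)`. -/
noncomputable def qPoch (q : ℂ) (n : ℕ) : ℂ := ∏ j ∈ range n, (1 - q ^ (j + 1))

/-- The reciprocal of `(q; q)_m`, extended by zero to negative integers `m`. -/
noncomputable def qPochInv (q : ℂ) (m : ℤ) : ℂ := if 0 ≤ m then (qPoch q m.toNat)⁻¹ else 0

lemma one_sub_pow_succ_ne_zero {q : ℂ} (hq : ‖q‖ < 1) (n : ℕ) : 1 - q ^ (n + 1) ≠ 0 := by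
  intro h
  have h1 : ‖q ^ (n + 1)‖ = 1 := by rw [← sub_eq_zero.mp h, norm_one]
  rw [norm_pow] at h1
  exact (pow_lt_one₀ (norm_nonneg q) hq n.succ_ne_zero).ne h1

lemma qPoch_ne_zero {q : ℂ} (hq : ‖q‖ < 1) (n : ℕ) : qPoch q n ≠ 0 :=
  prod_ne_zero_iff.mpr fun j _ => one_sub_pow_succ_ne_zero hq j

lemma exists_tendsto_qPoch {q : ℂ} (hq : ‖q‖ < 1) :
    ∃ L : ℂ, L ≠ 0 ∧ Tendsto (qPoch q) atTop (𝓝 L) := by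
  have hs : Summable fun n : ℕ => ‖-q ^ (n + 1)‖ := by
    simpa using (summable_nat_add_iff 1).mpr (summable_geometric_of_lt_one (norm_nonneg _) hq)
  refine ⟨∏' n : ℕ, (1 + -q ^ (n + 1)), tprod_one_add_ne_zero_of_summable ?_ hs, ?_⟩
  · intro n
    simpa [← sub_eq_add_neg] using one_sub_pow_succ_ne_zero hq n
  · refine Tendsto.congr (fun n => ?_)
      (multipliable_one_add_of_summable hs).hasProd.tendsto_prod_nat
    simp [qPoch, ← sub_eq_add_neg]

lemma tendsto_qPochInv {q L : ℂ} (hL : L ≠ 0) (h : Tendsto (qPoch q) atTop (𝓝 L)) :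
    Tendsto (qPochInv q) atTop (𝓝 L⁻¹) := by
  have ht : Tendsto Int.toNat atTop atTop :=
    tendsto_atTop.2 fun b => (eventually_ge_atTop (b : ℤ)).mono fun m hm => by omega
  refine ((h.inv₀ hL).comp ht).congr' ?_
  filter_upwards [eventually_ge_atTop (0 : ℤ)] with m hm
  simp [qPochInv, hm]

lemma exists_norm_qPoch_le {q L : ℂ} (h : Tendsto (qPoch q) atTop (𝓝 L)) :
    ∃ C, ∀ n, ‖qPoch q n‖ ≤ C := by
  obtain ⟨C, hC⟩ := (Metric.isBounded_range_of_tendsto _ h).exists_norm_le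
  exact ⟨C, fun n => hC _ ⟨n, rfl⟩⟩

lemma exists_norm_qPochInv_le {q L : ℂ} (hL : L ≠ 0) (h : Tendsto (qPoch q) atTop (𝓝 L)) :
    ∃ C, ∀ m, ‖qPochInv q m‖ ≤ C := by
  obtain ⟨C, hC⟩ := (Metric.isBounded_range_of_tendsto _ (h.inv₀ hL)).exists_norm_le
  refine ⟨C, fun m => ?_⟩
  unfold qPochInv
  split_ifs
  · exact hC _ ⟨m.toNat, rfl⟩
  · simpa using (norm_nonneg _).trans (hC _ ⟨0, rfl⟩)

/-- The finite `q`-binomial theorem, for any sequence `g` satisfying the recurrence of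
`(-1)^a q^(a(a-1)/2) x^a`. -/
lemma qPoch_mul_sum_antidiagonal {q x : ℂ} (hq : ‖q‖ < 1) {g : ℕ → ℂ}
    (hg : ∀ a, g (a + 1) = -q ^ a * x * g a) (M : ℕ) :
    qPoch q M * ∑ p ∈ antidiagonal M, g p.1 * (qPoch q p.1)⁻¹ * (qPoch q p.2)⁻¹ =
      g 0 * ∏ j ∈ range M, (1 - q ^ j * x) := by
  have hu : ∀ a, (1 - q ^ (a + 1)) * (qPoch q (a + 1))⁻¹ = (qPoch q a)⁻¹ := by
    intro a
    have h1 := qPoch_ne_zero hq a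
    have h2 := one_sub_pow_succ_ne_zero hq a
    rw [show qPoch q (a + 1) = qPoch q a * (1 - q ^ (a + 1)) from prod_range_succ _ _]
    field_simp
  induction M with
  | zero => simp [qPoch]
  | succ M ih =>
    have key : (1 - q ^ (M + 1)) *
        ∑ p ∈ antidiagonal (M + 1), g p.1 * (qPoch q p.1)⁻¹ * (qPoch q p.2)⁻¹ =
        (1 - q ^ M * x) * ∑ p ∈ antidiagonal M, g p.1 * (qPoch q p.1)⁻¹ * (qPoch q p.2)⁻¹ := by
      have split : (1 - q ^ (M + 1)) *
          ∑ p ∈ antidiagonal (M + 1), g p.1 * (qPoch q p.1)⁻¹ * (qPoch q p.2)⁻¹ =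
          ∑ p ∈ antidiagonal (M + 1),
            g p.1 * (qPoch q p.1)⁻¹ * ((1 - q ^ p.2) * (qPoch q p.2)⁻¹) +
          ∑ p ∈ antidiagonal (M + 1),
            g p.1 * ((1 - q ^ p.1) * (qPoch q p.1)⁻¹) * (q ^ p.2 * (qPoch q p.2)⁻¹) := by
        rw [mul_sum, ← sum_add_distrib]
        refine sum_congr rfl fun p hp => ?_
        rw [← HasAntidiagonal.mem_antidiagonal.mp hp, pow_add]
        ring
      rw [split, Finset.Nat.sum_antidiagonal_succ', Finset.Nat.sum_antidiagonal_succ]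
      simp only [pow_zero, sub_self, zero_mul, mul_zero, zero_add, hu]
      rw [mul_sum, ← sum_add_distrib]
      refine sum_congr rfl fun p hp => ?_
      rw [← HasAntidiagonal.mem_antidiagonal.mp hp, pow_add, hg]
      ring
    rw [show qPoch q (M + 1) = qPoch q M * (1 - q ^ (M + 1)) from prod_range_succ _ _,
      mul_assoc, key, prod_range_succ, ← mul_assoc (g 0), ← ih]
    ring

lemma theta1Term_succ (τ z : ℂ) (m : ℤ) :
    theta1Term τ z (m + 1) =
      -Complex.exp (2 * π * I * τ) ^ m * Complex.exp (2 * π * I * z) * theta1Term τ z m := by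
  unfold theta1Term
  rw [zpow_add_one₀ (by norm_num), ← Complex.exp_int_mul]
  have h : Complex.exp (π * I * (((m + 1 : ℤ) : ℂ) - 1/2)^2 * τ) *
      Complex.exp (2 * π * I * (((m + 1 : ℤ) : ℂ) - 1/2) * z) =
      Complex.exp (m * (2 * π * I * τ)) * Complex.exp (2 * π * I * z) *
        (Complex.exp (π * I * ((m : ℂ) - 1/2)^2 * τ) * Complex.exp (2 * π * I * ((m : ℂ) - 1/2) * z)) := by
    simp only [← Complex.exp_add]
    congr 1
    push_cast
    ring
  linear_combination (-(-1 : ℂ) ^ m) * h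

lemma theta1Term_zero (τ z : ℂ) :
    theta1Term τ z 0 = Complex.exp (2 * π * I * τ / 8) * Complex.exp (-(π * I * z)) := by
  simp only [theta1Term, zpow_zero, one_mul, Int.cast_zero]
  congr 2 <;> ring

lemma summable_theta1Term {τ : ℂ} (hτ : 0 < τ.im) (z : ℂ) : Summable (theta1Term τ z) := by
  refine (((summable_jacobiTheta₂_term_iff (z - τ / 2 + 1 / 2) τ).mpr hτ).mul_left
    (theta1Term τ z 0)).congr fun n => ?_
  have h : (-1 : ℂ) ^ n = Complex.exp (n * (π * I)) := by rw [Complex.exp_int_mul, Complex.exp_pi_mul_I]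
  rw [theta1Term_zero, theta1Term, jacobiTheta₂_term, h]
  simp only [← Complex.exp_add]
  congr 1
  ring

/-- Reflection of the factors with negative powers of `q`. -/
lemma theta1Term_neg_mul_prod (τ z : ℂ) (N : ℕ) :
    theta1Term τ z (-N) * ∏ j ∈ range N,
        (1 - Complex.exp (2 * π * I * τ) ^ ((j : ℤ) - N) * Complex.exp (2 * π * I * z)) =
      theta1Term τ z 0 * ∏ j ∈ range N,
        (1 - Complex.exp (2 * π * I * τ) ^ (j + 1) * (Complex.exp (2 * π * I * z))⁻¹) := by
  induction N with
  | zero => simp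
  | succ N ih =>
    rw [prod_range_succ', prod_range_succ, ← mul_assoc (theta1Term τ z 0), ← ih]
    have h := theta1Term_succ τ z (-((N + 1 : ℕ) : ℤ))
    have e : -((N + 1 : ℕ) : ℤ) + 1 = -N := by push_cast; ring
    rw [e] at h
    have hp : ∏ k ∈ range N, (1 - Complex.exp (2 * π * I * τ) ^ (((k + 1 : ℕ) : ℤ) - ((N + 1 : ℕ) : ℤ)) *
        Complex.exp (2 * π * I * z)) =
        ∏ k ∈ range N, (1 - Complex.exp (2 * π * I * τ) ^ ((k : ℤ) - N) * Complex.exp (2 * π * I * z)) := by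
      refine prod_congr rfl fun k _ => ?_
      congr 3
      push_cast
      ring
    rw [hp, h, Nat.cast_zero, zero_sub, zpow_neg, zpow_natCast]
    have h1 : Complex.exp (2 * π * I * τ) ^ (N + 1) ≠ 0 := pow_ne_zero _ (Complex.exp_ne_zero _)
    have h2 := Complex.exp_ne_zero (2 * π * I * z)
    generalize ∏ k ∈ range N, (1 - Complex.exp (2 * π * I * τ) ^ ((k : ℤ) - N) * Complex.exp (2 * π * I * z)) = P
    field_simp
    ring

lemma norm_exp_two_pi_I_mul_lt_one {τ : ℂ} (hτ : 0 < τ.im) : ‖Complex.exp (2 * π * I * τ)‖ < 1 := by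
  simpa using UpperHalfPlane.norm_exp_two_pi_I_lt_one ⟨τ, hτ⟩

/-- The finite form of the Jacobi triple product. -/
lemma tsum_qPochInv_mul_theta1Term {τ : ℂ} (hτ : 0 < τ.im) (z : ℂ) (N : ℕ) :
    ∑' m : ℤ, qPoch (Complex.exp (2 * π * I * τ)) (2 * N) * qPoch (Complex.exp (2 * π * I * τ)) N *
        qPochInv (Complex.exp (2 * π * I * τ)) (N + m) * qPochInv (Complex.exp (2 * π * I * τ)) (N - m) *
        theta1Term τ z m =
      theta1Term τ z 0 * ∏ n ∈ range N, theta1ProdTerm τ z n := by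
  have hq := norm_exp_two_pi_I_mul_lt_one hτ
  have hrefl := theta1Term_neg_mul_prod τ z N
  have hrec : ∀ a : ℕ, theta1Term τ z (((a + 1 : ℕ) : ℤ) - N) =
      -Complex.exp (2 * π * I * τ) ^ a * (Complex.exp (2 * π * I * τ) ^ (-(N : ℤ)) * Complex.exp (2 * π * I * z)) *
        theta1Term τ z ((a : ℤ) - N) := by
    intro a
    rw [show ((a + 1 : ℕ) : ℤ) - N = ((a : ℤ) - N) + 1 by push_cast; ring, theta1Term_succ,
      sub_eq_add_neg, zpow_add₀ (Complex.exp_ne_zero _), zpow_natCast]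
    ring
  have hfin := qPoch_mul_sum_antidiagonal hq (g := fun a : ℕ => theta1Term τ z ((a : ℤ) - N))
    hrec (2 * N)
  have hq0 : Complex.exp (2 * π * I * τ) ≠ 0 := Complex.exp_ne_zero _
  have hprod : ∏ n ∈ range N, theta1ProdTerm τ z n = qPoch (Complex.exp (2 * π * I * τ)) N *
      (∏ j ∈ range N, (1 - Complex.exp (2 * π * I * τ) ^ j * Complex.exp (2 * π * I * z))) *
      ∏ j ∈ range N, (1 - Complex.exp (2 * π * I * τ) ^ (j + 1) * (Complex.exp (2 * π * I * z))⁻¹) := by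
    simp only [theta1ProdTerm, qPoch, prod_mul_distrib]
  rw [hprod]
  generalize Complex.exp (2 * π * I * τ) = q at *
  generalize Complex.exp (2 * π * I * z) = y at *
  have hsum : ∑' m : ℤ, qPoch q (2 * N) * qPoch q N * qPochInv q (N + m) * qPochInv q (N - m) *
      theta1Term τ z m = qPoch q N * (qPoch q (2 * N) * ∑ p ∈ antidiagonal (2 * N),
        theta1Term τ z ((p.1 : ℤ) - N) * (qPoch q p.1)⁻¹ * (qPoch q p.2)⁻¹) := by
    rw [tsum_eq_sum (s := Icc (-(N : ℤ)) N), mul_sum, mul_sum]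
    · refine sum_nbij' (fun m => ((N + m).toNat, (N - m).toNat)) (fun p => (p.1 : ℤ) - N)
        ?_ ?_ ?_ ?_ ?_
      · intro m hm
        simp only [mem_Icc, HasAntidiagonal.mem_antidiagonal] at *
        omega
      · intro p hp
        simp only [mem_Icc, HasAntidiagonal.mem_antidiagonal] at *
        omega
      · intro m hm
        simp only [mem_Icc] at *
        omega
      · rintro ⟨a, b⟩ hp
        simp only [HasAntidiagonal.mem_antidiagonal, Prod.mk.injEq] at *
        omega
      · intro m hm
        rw [mem_Icc] at hm
        have h1 : 0 ≤ (N : ℤ) + m := by omega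
        have h2 : 0 ≤ (N : ℤ) - m := by omega
        simp only [qPochInv, h1, h2, if_true, Int.toNat_of_nonneg, add_sub_cancel_left]
        ring
    · intro m hm
      rw [mem_Icc, not_and_or] at hm
      rcases hm with hm | hm
      · rw [show qPochInv q (N + m) = 0 from if_neg (by omega)]
        ring
      · rw [show qPochInv q (N - m) = 0 from if_neg (by omega)]
        ring
  rw [hsum, hfin, two_mul, prod_range_add]
  have e1 : ∏ j ∈ range N, (1 - q ^ j * (q ^ (-(N : ℤ)) * y)) =
      ∏ j ∈ range N, (1 - q ^ ((j : ℤ) - N) * y) := by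
    refine prod_congr rfl fun j _ => ?_
    rw [sub_eq_add_neg (j : ℤ), zpow_add₀ hq0, zpow_natCast]
    ring
  have e2 : ∏ j ∈ range N, (1 - q ^ (N + j) * (q ^ (-(N : ℤ)) * y)) =
      ∏ j ∈ range N, (1 - q ^ j * y) := by
    refine prod_congr rfl fun j _ => ?_
    rw [pow_add, zpow_neg, zpow_natCast]
    field_simp
  rw [e1, e2, Nat.cast_zero, zero_sub]
  linear_combination qPoch q N * (∏ j ∈ range N, (1 - q ^ j * y)) * hrefl

lemma summable_norm_theta1ProdTerm_sub_one {τ : ℂ} (hτ : 0 < τ.im) (z : ℂ) :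
    Summable fun n : ℕ => ‖theta1ProdTerm τ z n - 1‖ := by
  have hq := norm_exp_two_pi_I_mul_lt_one hτ
  have hy := Complex.exp_ne_zero (2 * π * I * z)
  simp only [theta1ProdTerm]
  generalize Complex.exp (2 * π * I * τ) = q at *
  generalize Complex.exp (2 * π * I * z) = y at *
  have hgeom : ∀ k : ℕ, Summable fun n : ℕ => (q ^ (k + 1)) ^ n := fun k =>
    summable_geometric_of_norm_lt_one
      (by rw [norm_pow]; exact pow_lt_one₀ (norm_nonneg q) hq k.succ_ne_zero)
  refine Summable.norm ((((hgeom 0).mul_left (-(q + y + q * y⁻¹))).add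
    ((hgeom 1).mul_left (q * y + q ^ 2 * y⁻¹ + q))).add ((hgeom 2).mul_left (-q ^ 2))
      |>.congr fun n => ?_)
  simp only [← pow_mul]
  field_simp
  ring

/-- For every `τ ∈ ℍ` and `z ∈ ℂ`, the series defining `θ₁` converges
absolutely and equals `q^(1/8) y^(-1/2)` times the absolutely convergent triple product
`∏_{n=1}^∞ (1-q^n)(1-q^(n-1)y)(1-q^n y⁻¹)`. -/
theorem theta1_product_expansion (τ : UpperHalfPlane) (z : ℂ) :
    Summable (fun n : ℤ => ‖theta1Term (τ : ℂ) z n‖) ∧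
    Summable (fun n : ℕ => ‖theta1ProdTerm (τ : ℂ) z n - 1‖) ∧
    Multipliable (fun n : ℕ => theta1ProdTerm (τ : ℂ) z n) ∧
    ∑' n : ℤ, theta1Term (τ : ℂ) z n =
      Complex.exp (2 * π * I * (τ : ℂ) / 8) * Complex.exp (-(π * I * z)) *
        ∏' n : ℕ, theta1ProdTerm (τ : ℂ) z n := by
  have hτ : 0 < (τ : ℂ).im := τ.im_pos
  generalize (τ : ℂ) = τ at *
  have hsum := (summable_theta1Term hτ z).norm
  have hprod := summable_norm_theta1ProdTerm_sub_one hτ z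
  have hmul : Multipliable (fun n : ℕ => theta1ProdTerm τ z n) := by
    simpa using multipliable_one_add_of_summable hprod
  refine ⟨hsum, hprod, hmul, ?_⟩
  obtain ⟨L, hL, hlim⟩ := exists_tendsto_qPoch (norm_exp_two_pi_I_mul_lt_one hτ)
  obtain ⟨C, hC⟩ := exists_norm_qPoch_le hlim
  obtain ⟨D, hD⟩ := exists_norm_qPochInv_le hL hlim
  have hinv := tendsto_qPochInv hL hlim
  have hfin := tsum_qPochInv_mul_theta1Term hτ z
  generalize Complex.exp (2 * π * I * τ) = q at *
  have hC0 : 0 ≤ C := (norm_nonneg _).trans (hC 0)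
  have hD0 : 0 ≤ D := (norm_nonneg _).trans (hD 0)
  have htend := tendsto_tsum_of_dominated_convergence (𝓕 := atTop)
    (f := fun (N : ℕ) (m : ℤ) => qPoch q (2 * N) * qPoch q N * qPochInv q (N + m) *
      qPochInv q (N - m) * theta1Term τ z m)
    (g := theta1Term τ z) (hsum.mul_left (C * C * D * D)) ?_ ?_
  · simp only [hfin] at htend
    rw [← theta1Term_zero]
    exact tendsto_nhds_unique htend (hmul.hasProd.tendsto_prod_nat.const_mul _)
  · intro m
    have h2N : Tendsto (fun N : ℕ => 2 * N) atTop atTop :=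
      tendsto_id.const_mul_atTop' two_pos
    have hadd : Tendsto (fun N : ℕ => (N : ℤ) + m) atTop atTop :=
      tendsto_atTop_add_const_right _ _ tendsto_natCast_atTop_atTop
    have hsub : Tendsto (fun N : ℕ => (N : ℤ) - m) atTop atTop :=
      tendsto_atTop_add_const_right _ _ tendsto_natCast_atTop_atTop
    have h := ((((hlim.comp h2N).mul hlim).mul (hinv.comp hadd)).mul (hinv.comp hsub)).mul_const
      (theta1Term τ z m)
    have e : L * L * L⁻¹ * L⁻¹ * theta1Term τ z m = theta1Term τ z m := by field_simp
    rwa [e] at h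
  · refine .of_forall fun N m => ?_
    simp only [norm_mul]
    gcongr
    exacts [hC _, hC _, hD _, hD _]
end

section
/- For every τ in the complex upper half-plane ℍ, the theta constants and the Dedekind eta function are nonzero: θ₂(τ,0) ≠ 0, θ₃(τ,0) ≠ 0, θ₄(τ,0) ≠ 0, and η(τ) ≠ 0. -/
open Complex Real

/-- Jacobi theta function `θ₂(τ,z) = Σ_{n∈ℤ} q^((n-1/2)²/2) y^(n-1/2)`. -/
noncomputable def theta2 (τ z : ℂ) : ℂ :=
  ∑' n : ℤ, Complex.exp (π * I * ((n : ℂ) - 1/2)^2 * τ) *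
    Complex.exp (2 * π * I * ((n : ℂ) - 1/2) * z)

/-- Jacobi theta function `θ₃(τ,z) = Σ_{n∈ℤ} q^(n²/2) y^n`. -/
noncomputable def theta3 (τ z : ℂ) : ℂ :=
  ∑' n : ℤ, Complex.exp (π * I * (n : ℂ)^2 * τ) * Complex.exp (2 * π * I * (n : ℂ) * z)

/-- Jacobi theta function `θ₄(τ,z) = Σ_{n∈ℤ} (-1)^n q^(n²/2) y^n`. -/
noncomputable def theta4 (τ z : ℂ) : ℂ :=
  ∑' n : ℤ, (-1 : ℂ) ^ n * Complex.exp (π * I * (n : ℂ)^2 * τ) *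
    Complex.exp (2 * π * I * (n : ℂ) * z)

/-- Dedekind eta function `η(τ) = q^(1/24) ∏_{n=1}^∞ (1-q^n)`. -/
noncomputable def dedekindEta (τ : ℂ) : ℂ :=
  Complex.exp (2 * π * I * τ / 24) *
    ∏' n : ℕ, (1 - Complex.exp (2 * π * I * τ) ^ (n + 1))

lemma exp_pi_mul_I_mul_int_sq (n : ℤ) : Complex.exp (π * I * (n : ℂ) ^ 2) = (-1) ^ n := by
  have h : (π * I * (n : ℂ) ^ 2 : ℂ) = n * (n * (π * I)) := by ring
  rw [h, Complex.exp_int_mul, Complex.exp_int_mul, Complex.exp_pi_mul_I, ← zpow_mul]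
  rcases Int.even_or_odd n with hn | hn
  · rw [hn.neg_one_zpow, (hn.mul_left n).neg_one_zpow]
  · rw [hn.neg_one_zpow, (hn.mul hn).neg_one_zpow]

lemma exp_pi_mul_I_mul_int_sq_mul_add_one (n : ℤ) (τ : ℂ) :
    Complex.exp (π * I * (n : ℂ) ^ 2 * (τ + 1)) =
      (-1) ^ n * Complex.exp (π * I * (n : ℂ) ^ 2 * τ) := by
  rw [mul_add, Complex.exp_add, mul_one, exp_pi_mul_I_mul_int_sq, mul_comm]

lemma summable_norm_exp_pi_mul_I_mul_int_sq {τ : ℂ} (hτ : 0 < τ.im) :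
    Summable fun n : ℤ ↦ ‖Complex.exp (π * I * (n : ℂ) ^ 2 * τ)‖ := by
  simpa [jacobiTheta₂_term] using ((summable_jacobiTheta₂_term_iff 0 τ).mpr hτ).norm

/-- If the off-parity part of a double series is antisymmetric and the rest is symmetric, then only
the terms `(a + b, a - b)` contribute. -/
lemma tsum_prod_eq_tsum_add_sub {F : ℤ × ℤ → ℂ} (hF : Summable F)
    (heven : ∀ a b, F (a - b, a + b) = F (a + b, a - b))
    (hodd : ∀ m n, Odd (m + n) → F (n, m) = -F (m, n)) :
    ∑' p, F p = ∑' p : ℤ × ℤ, F (p.1 + p.2, p.1 - p.2) := by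
  have hinj : Function.Injective fun p : ℤ × ℤ ↦ (p.1 + p.2, p.1 - p.2) := by
    rintro ⟨a, b⟩ ⟨c, d⟩ h
    simp only [Prod.mk.injEq] at h ⊢
    omega
  have hswap : Summable fun p : ℤ × ℤ ↦ F p.swap := (Equiv.prodComm ℤ ℤ).summable_iff.mpr hF
  have hsum : ∑' p : ℤ × ℤ, F p.swap = ∑' p, F p := (Equiv.prodComm ℤ ℤ).tsum_eq F
  have hsym : ∑' p : ℤ × ℤ, (F p + F p.swap) / 2 = ∑' p, F p := by
    rw [tsum_div_const, hF.tsum_add hswap, hsum]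
    ring
  rw [← hsym, ← hinj.tsum_eq]
  · refine tsum_congr fun p ↦ ?_
    rw [Prod.swap_prod_mk, heven]
    ring
  · rintro ⟨m, n⟩ hmn
    rcases Int.even_or_odd' (m + n) with ⟨k, hk | hk⟩
    · exact ⟨(k, k - n), by simp only [Prod.mk.injEq]; omega⟩
    · exact absurd (by simp [hodd m n ⟨k, hk⟩]) hmn

/-- The duplication formula `θ₃(τ) θ₄(τ) = θ₄(2τ)²`. -/
lemma jacobiTheta_mul_jacobiTheta_add_one {τ : ℂ} (hτ : 0 < τ.im) :
    jacobiTheta τ * jacobiTheta (τ + 1) = jacobiTheta (2 * τ + 1) ^ 2 := by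
  have h1 : 0 < (τ + 1).im := by simpa using hτ
  have h2 : 0 < (2 * τ + 1).im := by simpa using hτ
  have s0 := summable_norm_exp_pi_mul_I_mul_int_sq hτ
  have s1 := summable_norm_exp_pi_mul_I_mul_int_sq h1
  have s2 := summable_norm_exp_pi_mul_I_mul_int_sq h2
  rw [sq]
  simp only [jacobiTheta]
  rw [tsum_mul_tsum_of_summable_norm s0 s1, tsum_mul_tsum_of_summable_norm s2 s2,
    tsum_prod_eq_tsum_add_sub (summable_mul_of_summable_norm s0 s1)]
  · refine tsum_congr fun p ↦ ?_
    simp only [exp_pi_mul_I_mul_int_sq_mul_add_one]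
    rw [mul_left_comm, mul_mul_mul_comm, ← Complex.exp_add, ← Complex.exp_add,
      zpow_sub₀ (by norm_num), div_eq_mul_inv, ← inv_zpow, inv_neg_one]
    push_cast
    ring_nf
  · intro a b
    simp only [exp_pi_mul_I_mul_int_sq_mul_add_one]
    rw [zpow_sub₀ (by norm_num), zpow_add₀ (by norm_num), div_eq_mul_inv, ← inv_zpow, inv_neg_one]
    ring
  · intro m n hmn
    have h : (-1 : ℂ) ^ m = -(-1) ^ n := by
      rcases Int.even_or_odd n with hn | hn
      · rw [hn.neg_one_zpow, ((Int.odd_add.mp hmn).mpr hn).neg_one_zpow]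
      · have hm : Even m := by
          rw [← Int.not_odd_iff_even, Int.odd_add.mp hmn, Int.not_even_iff_odd]
          exact hn
        rw [hn.neg_one_zpow, hm.neg_one_zpow, neg_neg]
    simp only [exp_pi_mul_I_mul_int_sq_mul_add_one, h]
    ring

lemma tendsto_jacobiTheta_comap_im_atTop :
    Filter.Tendsto jacobiTheta (Filter.comap im Filter.atTop) (nhds 1) := by
  refine tendsto_sub_nhds_zero_iff.mp
    (isBigO_at_im_infty_jacobiTheta_sub_one.trans_tendsto ?_)
  refine Real.tendsto_exp_atBot.comp (Filter.Tendsto.const_mul_atTop_of_neg ?_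
    Filter.tendsto_comap)
  simpa using Real.pi_pos

lemma jacobiTheta_add_one_ne_zero {τ : ℂ} (hτ : 0 < τ.im) : jacobiTheta (τ + 1) ≠ 0 := by
  intro h
  have him (k : ℕ) : (2 ^ k * τ).im = 2 ^ k * τ.im := by
    rw [show (2 : ℂ) ^ k = ((2 ^ k : ℝ) : ℂ) by push_cast; rfl, im_ofReal_mul]
  have hzero (k : ℕ) : jacobiTheta (2 ^ k * τ + 1) = 0 := by
    induction k with
    | zero => simpa using h
    | succ k ih =>
      have hk : 0 < (2 ^ k * τ).im := by rw [him]; positivity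
      have := jacobiTheta_mul_jacobiTheta_add_one hk
      rw [ih, mul_zero, ← mul_assoc, ← pow_succ'] at this
      exact pow_eq_zero_iff two_ne_zero |>.mp this.symm
  have hlim : Filter.Tendsto (fun k : ℕ ↦ (2 : ℂ) ^ k * τ + 1) Filter.atTop
      (Filter.comap im Filter.atTop) := by
    refine Filter.tendsto_comap_iff.mpr ?_
    simp only [Function.comp_def, add_im, him, one_im, add_zero]
    exact (tendsto_pow_atTop_atTop_of_one_lt one_lt_two).atTop_mul_const hτ
  have := tendsto_jacobiTheta_comap_im_atTop.comp hlim
  simp only [Function.comp_def, hzero] at this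
  exact zero_ne_one (tendsto_nhds_unique tendsto_const_nhds this)

lemma jacobiTheta_ne_zero {τ : ℂ} (hτ : 0 < τ.im) : jacobiTheta τ ≠ 0 := by
  have := jacobiTheta_add_one_ne_zero (τ := τ - 1) (by simpa using hτ)
  rwa [sub_add_cancel] at this

lemma theta3_zero_right (τ : ℂ) : theta3 τ 0 = jacobiTheta τ := by
  simp [theta3, jacobiTheta]

lemma theta4_zero_right (τ : ℂ) : theta4 τ 0 = jacobiTheta (τ + 1) := by
  simp [theta4, jacobiTheta, exp_pi_mul_I_mul_int_sq_mul_add_one]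

lemma theta2_zero_right (τ : ℂ) :
    theta2 τ 0 = Complex.exp (π * I * τ / 4) * jacobiTheta₂ (-τ / 2) τ := by
  simp only [theta2, jacobiTheta₂, ← tsum_mul_left, jacobiTheta₂_term, ← Complex.exp_add]
  refine tsum_congr fun n ↦ ?_
  congr 1
  ring

lemma jacobiTheta₂_half (τ : ℂ) : jacobiTheta₂ (1 / 2) τ = jacobiTheta (τ + 1) := by
  refine tsum_congr fun n ↦ ?_
  rw [exp_pi_mul_I_mul_int_sq_mul_add_one, jacobiTheta₂_term, Complex.exp_add,
    ← Complex.exp_pi_mul_I, ← Complex.exp_int_mul]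
  congr 2
  ring

lemma theta2_zero_right_ne_zero (τ : UpperHalfPlane) : theta2 (τ : ℂ) 0 ≠ 0 := by
  have hτ : (τ : ℂ) ≠ 0 := τ.ne_zero
  have him : 0 < (-1 / (τ : ℂ)).im := by
    simpa [neg_div, inv_neg] using UpperHalfPlane.im_inv_neg_coe_pos τ
  have h := jacobiTheta₂_functional_equation (-τ / 2) τ
  rw [show -(τ : ℂ) / 2 / τ = -(1 / 2) by field_simp, jacobiTheta₂_neg_left,
    jacobiTheta₂_half] at h
  rw [theta2_zero_right, h]
  refine mul_ne_zero (Complex.exp_ne_zero _) (mul_ne_zero (mul_ne_zero ?_ (Complex.exp_ne_zero _))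
    (jacobiTheta_add_one_ne_zero him))
  exact one_div_ne_zero (by simp [Complex.cpow_eq_zero_iff, hτ])

lemma dedekindEta_eq_eta (τ : ℂ) : dedekindEta τ = ModularForm.eta τ := by
  simp [dedekindEta, ModularForm.eta, ModularForm.eta_q_eq_pow, Function.Periodic.qParam]

/-- For every `τ ∈ ℍ`, the theta constants `θ₂(τ,0)`, `θ₃(τ,0)`, `θ₄(τ,0)`
and the Dedekind eta function `η(τ)` are all nonzero. -/
theorem theta_constants_and_eta_ne_zero (τ : UpperHalfPlane) :
    theta2 (τ : ℂ) 0 ≠ 0 ∧ theta3 (τ : ℂ) 0 ≠ 0 ∧ theta4 (τ : ℂ) 0 ≠ 0 ∧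
      dedekindEta (τ : ℂ) ≠ 0 := by
  exact ⟨theta2_zero_right_ne_zero τ,
    theta3_zero_right τ ▸ jacobiTheta_ne_zero τ.im_pos,
    theta4_zero_right τ ▸ jacobiTheta_add_one_ne_zero τ.im_pos,
    dedekindEta_eq_eta τ ▸ ModularForm.eta_ne_zero τ.im_pos⟩
end

section
/- For every τ in the complex upper half-plane ℍ and every z ∈ ℂ, the N=4 vacuum character χ₀ at central charge 6 is elliptic of index 1 in z with respect to the lattice ℤτ + ℤ: χ₀(τ, z+1) = χ₀(τ, z) and χ₀(τ, z+τ) = q^{−1} y^{−2} χ₀(τ, z). -/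
open Complex Real

/-- Jacobi theta function `θ₁(τ,z) = i Σ_{n∈ℤ} (-1)^n q^((n-1/2)²/2) y^(n-1/2)`. -/
noncomputable def theta1 (τ z : ℂ) : ℂ :=
  I * ∑' n : ℤ, (-1 : ℂ) ^ n * Complex.exp (π * I * ((n : ℂ) - 1/2)^2 * τ) *
    Complex.exp (2 * π * I * ((n : ℂ) - 1/2) * z)

/-- The Mordell function `h₃(τ) = (1/(η(τ)θ₃(τ,0))) Σ_{m∈ℤ} q^(m²/2-1/8)/(1+q^(m-1/2))`. -/
noncomputable def mordellH3 (τ : ℂ) : ℂ :=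
  (1 / (dedekindEta τ * theta3 τ 0)) *
    ∑' m : ℤ, Complex.exp (2 * π * I * ((m : ℂ)^2 / 2 - 1/8) * τ) /
      (1 + Complex.exp (2 * π * I * ((m : ℂ) - 1/2) * τ))

/-- The `N=4` vacuum character at central charge 6 (twisted Ramond sector):
`χ₀(τ,z) = -2(θ₃(τ,z)/θ₃(τ,0))² + (q^(-1/8)/η(τ) - 2h₃(τ))(θ₁(τ,z)/η(τ))²`. -/
noncomputable def chi0 (τ z : ℂ) : ℂ :=
  -2 * (theta3 τ z / theta3 τ 0)^2 +
    (Complex.exp (2 * π * I * (-1/8 : ℂ) * τ) / dedekindEta τ - 2 * mordellH3 τ) *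
      (theta1 τ z / dedekindEta τ)^2

/-- The massless matter `N=4` character at central charge 6:
`χ_mm(τ,z) = (θ₃(τ,z)/θ₃(τ,0))² + h₃(τ)(θ₁(τ,z)/η(τ))²`. -/
noncomputable def chimm (τ z : ℂ) : ℂ :=
  (theta3 τ z / theta3 τ 0)^2 + mordellH3 τ * (theta1 τ z / dedekindEta τ)^2

/-- The massive `N=4` character function at central charge 6:
`χ̂(τ,z) = (q^(-1/8)/η(τ))(θ₁(τ,z)/η(τ))²`. -/
noncomputable def chihat (τ z : ℂ) : ℂ :=
  (Complex.exp (2 * π * I * (-1/8 : ℂ) * τ) / dedekindEta τ) *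
    (theta1 τ z / dedekindEta τ)^2

/-- The complex elliptic genus of a K3 surface:
`E_K3(τ,z) = 8[(θ₂(τ,z)/θ₂(τ,0))² + (θ₃(τ,z)/θ₃(τ,0))² + (θ₄(τ,z)/θ₄(τ,0))²]`. -/
noncomputable def EK3 (τ z : ℂ) : ℂ :=
  8 * ((theta2 τ z / theta2 τ 0)^2 + (theta3 τ z / theta3 τ 0)^2 +
    (theta4 τ z / theta4 τ 0)^2)

lemma theta1_add_one (τ z : ℂ) : theta1 τ (z + 1) = -theta1 τ z := by
  have key (n : ℤ) : Complex.exp (2 * π * I * ((n : ℂ) - 1/2) * (z + 1)) =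
      -1 * Complex.exp (2 * π * I * ((n : ℂ) - 1/2) * z) := by
    rw [show 2 * π * I * ((n : ℂ) - 1/2) * (z + 1) =
      n * (2 * π * I) + (-(π * I) + 2 * π * I * ((n : ℂ) - 1/2) * z) by ring,
      Complex.exp_add, Complex.exp_int_mul_two_pi_mul_I, Complex.exp_add, Complex.exp_neg,
      Complex.exp_pi_mul_I]
    norm_num
  simp only [theta1, key, neg_one_mul, mul_neg, tsum_neg]

lemma theta3_add_one (τ z : ℂ) : theta3 τ (z + 1) = theta3 τ z := by
  have key (n : ℤ) : Complex.exp (2 * π * I * (n : ℂ) * (z + 1)) =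
      Complex.exp (2 * π * I * (n : ℂ) * z) := by
    rw [show 2 * π * I * (n : ℂ) * (z + 1) = n * (2 * π * I) + 2 * π * I * (n : ℂ) * z by ring,
      Complex.exp_add, Complex.exp_int_mul_two_pi_mul_I, one_mul]
  simp only [theta3, key]

lemma theta1_add_tau (τ z : ℂ) :
    theta1 τ (z + τ) = -(Complex.exp (-(π * I * τ) - 2 * π * I * z) * theta1 τ z) := by
  unfold theta1
  rw [← (Equiv.addRight (1 : ℤ)).tsum_eq (fun n : ℤ ↦ (-1 : ℂ) ^ n *
      Complex.exp (π * I * ((n : ℂ) - 1/2)^2 * τ) *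
      Complex.exp (2 * π * I * ((n : ℂ) - 1/2) * z)),
    mul_left_comm, ← mul_neg]
  congr 1
  rw [← neg_mul, ← tsum_mul_left]
  congr 1
  ext n
  have hexp : Complex.exp (π * I * ((n : ℂ) - 1/2)^2 * τ) *
      Complex.exp (2 * π * I * ((n : ℂ) - 1/2) * (z + τ)) =
      Complex.exp (-(π * I * τ) - 2 * π * I * z) *
        (Complex.exp (π * I * (((n + 1 : ℤ) : ℂ) - 1/2)^2 * τ) *
          Complex.exp (2 * π * I * (((n + 1 : ℤ) : ℂ) - 1/2) * z)) := by
    rw [← Complex.exp_add, ← Complex.exp_add, ← Complex.exp_add]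
    congr 1
    push_cast
    ring
  rw [Equiv.coe_addRight, zpow_add_one₀ (by norm_num), mul_assoc, hexp]
  ring

lemma theta3_add_tau (τ z : ℂ) :
    theta3 τ (z + τ) = Complex.exp (-(π * I * τ) - 2 * π * I * z) * theta3 τ z := by
  unfold theta3
  rw [← (Equiv.addRight (1 : ℤ)).tsum_eq (fun n : ℤ ↦ Complex.exp (π * I * (n : ℂ)^2 * τ) *
      Complex.exp (2 * π * I * (n : ℂ) * z)), ← tsum_mul_left]
  congr 1
  ext n
  rw [Equiv.coe_addRight, ← Complex.exp_add, ← Complex.exp_add, ← Complex.exp_add]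
  congr 1
  push_cast
  ring

/-- For every `τ ∈ ℍ` and `z ∈ ℂ`, the `N=4` vacuum character `χ₀` at
central charge 6 is elliptic of index 1 in `z` with respect to `ℤτ + ℤ`:
`χ₀(τ, z+1) = χ₀(τ, z)` and `χ₀(τ, z+τ) = q⁻¹ y⁻² χ₀(τ, z)`. -/
theorem chi0_elliptic (τ : UpperHalfPlane) (z : ℂ) :
    chi0 (τ : ℂ) (z + 1) = chi0 (τ : ℂ) z ∧
    chi0 (τ : ℂ) (z + (τ : ℂ)) =
      (Complex.exp (2 * π * I * (τ : ℂ)))⁻¹ * ((Complex.exp (2 * π * I * z))^2)⁻¹ *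
        chi0 (τ : ℂ) z := by
  refine ⟨by simp only [chi0, theta1_add_one, theta3_add_one, neg_div, neg_sq], ?_⟩
  have hsq : (Complex.exp (2 * π * I * (τ : ℂ)))⁻¹ * ((Complex.exp (2 * π * I * z))^2)⁻¹ =
      Complex.exp (-(π * I * (τ : ℂ)) - 2 * π * I * z) ^ 2 := by
    rw [← Complex.exp_nat_mul, ← Complex.exp_nat_mul, ← Complex.exp_neg, ← Complex.exp_neg,
      ← Complex.exp_add]
    congr 1
    push_cast
    ring
  rw [hsq]
  simp only [chi0, theta1_add_tau, theta3_add_tau]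
  ring
end

section
/- The chiral Hodge-elliptic genus of a K3 surface, given by F(τ,z,ν) = (2 − u − u^{−1})·χ₀(τ,z) + E_K3(τ,z), is elliptic of index 1 in z with respect to the lattice ℤτ + ℤ: for every τ in the complex upper half-plane ℍ and all z, ν ∈ ℂ, F(τ, z+1, ν) = F(τ, z, ν) and F(τ, z+τ, ν) = q^{−1} y^{−2} F(τ, z, ν). -/
open Complex Real

/-- The chiral Hodge-elliptic genus of a K3 surface:
`F(τ,z,ν) = (2 - u - u⁻¹)·χ₀(τ,z) + E_K3(τ,z)` where `u = exp(2πiν)`. -/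
noncomputable def chiralHodgeK3 (τ z ν : ℂ) : ℂ :=
  (2 - Complex.exp (2 * π * I * ν) - (Complex.exp (2 * π * I * ν))⁻¹) * chi0 τ z +
    EK3 τ z

/-- Theta series `Σ_{n∈ℤ} εⁿ q^((n-c)²/2) y^(n-c)` with sign `ε` and shift `c`. -/
noncomputable def thetaSeries (ε c τ z : ℂ) : ℂ :=
  ∑' n : ℤ, ε ^ n * Complex.exp (π * I * ((n : ℂ) - c) ^ 2 * τ) *
    Complex.exp (2 * π * I * ((n : ℂ) - c) * z)

theorem thetaSeries_add_one (ε c τ z : ℂ) :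
    thetaSeries ε c τ (z + 1) = Complex.exp (-(2 * π * I * c)) * thetaSeries ε c τ z := by
  unfold thetaSeries
  rw [← tsum_mul_left]
  congr 1 with n
  have h : Complex.exp (2 * π * I * ((n : ℂ) - c) * (z + 1)) =
      Complex.exp (-(2 * π * I * c)) * Complex.exp (2 * π * I * ((n : ℂ) - c) * z) := by
    rw [← Complex.exp_add, Complex.exp_eq_exp_iff_exists_int]
    exact ⟨n, by ring⟩
  rw [h]
  ring

theorem thetaSeries_add_tau {ε : ℂ} (hε : ε ≠ 0) (c τ z : ℂ) :
    thetaSeries ε c τ (z + τ) =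
      ε⁻¹ * Complex.exp (-(π * I * τ) - 2 * π * I * z) * thetaSeries ε c τ z := by
  unfold thetaSeries
  rw [← (Equiv.addRight (1 : ℤ)).tsum_eq (fun n : ℤ ↦
    ε ^ n * Complex.exp (π * I * ((n : ℂ) - c) ^ 2 * τ) *
      Complex.exp (2 * π * I * ((n : ℂ) - c) * z)), ← tsum_mul_left]
  congr 1 with n
  have h : Complex.exp (π * I * ((n : ℂ) - c) ^ 2 * τ) *
        Complex.exp (2 * π * I * ((n : ℂ) - c) * (z + τ)) =
      Complex.exp (-(π * I * τ) - 2 * π * I * z) *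
        (Complex.exp (π * I * (((n + 1 : ℤ) : ℂ) - c) ^ 2 * τ) *
          Complex.exp (2 * π * I * (((n + 1 : ℤ) : ℂ) - c) * z)) := by
    simp only [← Complex.exp_add]
    push_cast
    ring_nf
  rw [Equiv.coe_addRight, zpow_add_one₀ hε, mul_assoc, h]
  field_simp

theorem thetaSeries_add_one_sq {c : ℂ} (hc : c = 0 ∨ c = 1 / 2) (ε τ z : ℂ) :
    thetaSeries ε c τ (z + 1) ^ 2 = thetaSeries ε c τ z ^ 2 := by
  have h : Complex.exp (-(2 * π * I * c)) ^ 2 = 1 := by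
    rw [← Complex.exp_nat_mul, Complex.exp_eq_one_iff]
    rcases hc with rfl | rfl
    · exact ⟨0, by simp⟩
    · exact ⟨-1, by push_cast; ring⟩
  rw [thetaSeries_add_one, mul_pow, h, one_mul]

theorem thetaSeries_add_tau_sq {ε : ℂ} (hε : ε = 1 ∨ ε = -1) (c τ z : ℂ) :
    thetaSeries ε c τ (z + τ) ^ 2 =
      (Complex.exp (2 * π * I * τ))⁻¹ * ((Complex.exp (2 * π * I * z)) ^ 2)⁻¹ *
        thetaSeries ε c τ z ^ 2 := by
  have h : Complex.exp (-(π * I * τ) - 2 * π * I * z) ^ 2 =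
      (Complex.exp (2 * π * I * τ))⁻¹ * ((Complex.exp (2 * π * I * z)) ^ 2)⁻¹ := by
    simp only [← Complex.exp_nat_mul, ← Complex.exp_neg, ← Complex.exp_add]
    push_cast
    ring_nf
  rw [thetaSeries_add_tau (by rcases hε with rfl | rfl <;> simp), mul_pow, mul_pow, h]
  rcases hε with rfl | rfl <;> norm_num

theorem theta1_eq (τ z : ℂ) : theta1 τ z = I * thetaSeries (-1) (1 / 2) τ z := rfl

theorem theta2_eq (τ z : ℂ) : theta2 τ z = thetaSeries 1 (1 / 2) τ z := by
  simp [theta2, thetaSeries]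

theorem theta3_eq (τ z : ℂ) : theta3 τ z = thetaSeries 1 0 τ z := by
  simp [theta3, thetaSeries]

theorem theta4_eq (τ z : ℂ) : theta4 τ z = thetaSeries (-1) 0 τ z := by
  simp [theta4, thetaSeries]

/-- The chiral Hodge-elliptic genus is a combination of squares of theta functions in `z`, so it
inherits any transformation law shared by all of these squares. -/
theorem chiralHodgeK3_eq_mul {τ z w k : ℂ} (ν : ℂ)
    (h : ∀ ε c : ℂ, (ε = 1 ∨ ε = -1) → (c = 0 ∨ c = 1 / 2) →
      thetaSeries ε c τ w ^ 2 = k * thetaSeries ε c τ z ^ 2) :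
    chiralHodgeK3 τ w ν = k * chiralHodgeK3 τ z ν := by
  have h1 : theta1 τ w ^ 2 = k * theta1 τ z ^ 2 := by
    rw [theta1_eq, theta1_eq, mul_pow, mul_pow, h _ _ (.inr rfl) (.inr rfl)]
    ring
  have h2 : theta2 τ w ^ 2 = k * theta2 τ z ^ 2 := by
    rw [theta2_eq, theta2_eq, h _ _ (.inl rfl) (.inr rfl)]
  have h3 : theta3 τ w ^ 2 = k * theta3 τ z ^ 2 := by
    rw [theta3_eq, theta3_eq, h _ _ (.inl rfl) (.inl rfl)]
  have h4 : theta4 τ w ^ 2 = k * theta4 τ z ^ 2 := by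
    rw [theta4_eq, theta4_eq, h _ _ (.inr rfl) (.inl rfl)]
  unfold chiralHodgeK3 chi0 EK3
  simp only [div_pow, h1, h2, h3, h4]
  ring

/-- The chiral Hodge-elliptic genus of a K3 surface is elliptic of index 1
in `z` with respect to `ℤτ + ℤ`: `F(τ, z+1, ν) = F(τ, z, ν)` and
`F(τ, z+τ, ν) = q⁻¹ y⁻² F(τ, z, ν)`. -/
theorem chiralHodgeK3_elliptic (τ : UpperHalfPlane) (z ν : ℂ) :
    chiralHodgeK3 (τ : ℂ) (z + 1) ν = chiralHodgeK3 (τ : ℂ) z ν ∧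
    chiralHodgeK3 (τ : ℂ) (z + (τ : ℂ)) ν =
      (Complex.exp (2 * π * I * (τ : ℂ)))⁻¹ * ((Complex.exp (2 * π * I * z))^2)⁻¹ *
        chiralHodgeK3 (τ : ℂ) z ν := by
  refine ⟨?_, chiralHodgeK3_eq_mul ν fun ε c hε _ ↦ thetaSeries_add_tau_sq hε c τ z⟩
  rw [← one_mul (chiralHodgeK3 τ z ν)]
  exact chiralHodgeK3_eq_mul ν fun ε c _ hc ↦ by rw [one_mul, thetaSeries_add_one_sq hc]
end

section
/- For every z ∈ ℂ, the N=4 vacuum character at central charge 6 has leading order term −y − y^{−1}: lim_{t → ∞} χ₀(it, z) = −exp(2πiz) − exp(−2πiz), the limit being taken along the positive imaginary axis τ = it, t ∈ ℝ, t → ∞. -/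
open Complex Real

/-- Dominated convergence for a Dirichlet-type series `∑ cₙ exp (-π t aₙ)` as `t → ∞`: only the
terms with `aₙ = 0` survive. -/
theorem tendsto_tsum_mul_exp_neg {a : ℤ → ℝ} {c : ℤ → ℂ} (s : Finset ℤ)
    (hs : ∀ n ∈ s, a n = 0) (hs' : ∀ n ∉ s, 0 < a n)
    (hsum : Summable fun n => ‖c n * Complex.exp (-(π * a n : ℝ))‖) :
    Filter.Tendsto (fun t : ℝ => ∑' n, c n * Complex.exp (-(π * a n * t : ℝ))) Filter.atTop
      (nhds (∑ n ∈ s, c n)) := by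
  have ha : ∀ n, 0 ≤ a n := fun n => by
    by_cases h : n ∈ s
    · exact (hs n h).ge
    · exact (hs' n h).le
  have hlim : ∑ n ∈ s, c n = ∑' n, (if n ∈ s then c n else 0) := by
    rw [tsum_eq_sum (s := s) fun n hn => if_neg hn]
    exact Finset.sum_congr rfl fun n hn => (if_pos hn).symm
  rw [hlim]
  refine tendsto_tsum_of_dominated_convergence hsum (fun n => ?_) ?_
  · by_cases hn : n ∈ s
    · simp [hn, hs n hn]
    · have h : Filter.Tendsto (fun t : ℝ => Real.exp (-(π * a n * t))) Filter.atTop (nhds 0) :=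
        Real.tendsto_exp_neg_atTop_nhds_zero.comp
          (Filter.tendsto_id.const_mul_atTop (mul_pos Real.pi_pos (hs' n hn)))
      have h' := (Complex.continuous_ofReal.tendsto 0).comp h
      simpa [hn, Function.comp_def] using h'.const_mul (c n)
  · filter_upwards [Filter.eventually_ge_atTop 1] with t ht n
    rw [norm_mul, norm_mul, ← Complex.ofReal_neg, ← Complex.ofReal_neg, Complex.norm_exp_ofReal,
      Complex.norm_exp_ofReal]
    refine mul_le_mul_of_nonneg_left (Real.exp_le_exp.2 (neg_le_neg ?_)) (norm_nonneg _)
    exact le_mul_of_one_le_right (mul_nonneg Real.pi_pos.le (ha n)) ht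

theorem summable_norm_gaussian (w : ℂ) :
    Summable fun n : ℤ => ‖Complex.exp (2 * π * I * n * w) *
      Complex.exp (-(π * (n : ℝ) ^ 2 : ℝ))‖ := by
  have h := ((summable_jacobiTheta₂_term_iff w I).2 (by simp)).norm
  refine h.congr fun n => ?_
  rw [jacobiTheta₂_term, ← Complex.exp_add]
  congr 2
  push_cast
  linear_combination (π * n ^ 2 : ℂ) * Complex.I_sq

theorem tendsto_theta3 (z : ℂ) :
    Filter.Tendsto (fun t : ℝ => theta3 (t * I) z) Filter.atTop (nhds 1) := by
  have h := tendsto_tsum_mul_exp_neg (a := fun n : ℤ => (n : ℝ) ^ 2)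
    (c := fun n : ℤ => Complex.exp (2 * π * I * n * z)) {0} (by simp)
    (fun n hn => by have : n ≠ 0 := by simpa using hn
                    positivity) (summable_norm_gaussian z)
  simp only [Finset.sum_singleton, Int.cast_zero, mul_zero, zero_mul, Complex.exp_zero] at h
  refine h.congr fun t => tsum_congr fun n => ?_
  rw [mul_comm]
  congr 2
  push_cast
  linear_combination (-π * n ^ 2 * t : ℂ) * Complex.I_sq

/-- `θ₁(it, z) / (i q^(1/8))` tends to `y^(-1/2) - y^(1/2)`. -/
theorem tendsto_theta1_normalized (z : ℂ) :
    Filter.Tendsto (fun t : ℝ => Complex.exp (π * t / 4) * theta1 (t * I) z) Filter.atTop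
      (nhds (I * (Complex.exp (-(π * I * z)) - Complex.exp (π * I * z)))) := by
  have h := tendsto_tsum_mul_exp_neg (a := fun n : ℤ => (n : ℝ) ^ 2 - n)
    (c := fun n : ℤ => (-1 : ℂ) ^ n * Complex.exp (2 * π * I * ((n : ℂ) - 1 / 2) * z)) {0, 1}
    (by simp)
    (fun n hn => by
      have h : n < 0 ∨ 1 < n := by
        simp only [Finset.mem_insert, Finset.mem_singleton] at hn
        omega
      have : 0 < n ^ 2 - n := by rcases h with h | h <;> nlinarith
      exact_mod_cast this)
    (by
      refine ((summable_norm_gaussian (z - I / 2)).mul_left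
        ‖Complex.exp (-(π * I * z))‖).congr fun n => ?_
      rw [← norm_mul, mul_assoc ((-1 : ℂ) ^ n), norm_mul ((-1 : ℂ) ^ n), norm_zpow, norm_neg, norm_one, one_zpow,
        one_mul, ← Complex.exp_add, ← Complex.exp_add, ← Complex.exp_add]
      congr 2
      push_cast
      linear_combination (-π * n : ℂ) * Complex.I_sq)
  rw [Finset.sum_pair (by norm_num)] at h
  convert (h.const_mul I).congr fun t => ?_ using 2
  · congr 1
    simp only [Int.cast_zero, Int.cast_one, zpow_zero, zpow_one, one_mul, neg_mul]
    rw [sub_eq_add_neg]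
    congr 2
    · ring_nf
    · ring_nf
  · rw [theta1, mul_left_comm]
    congr 1
    rw [← tsum_mul_left]
    refine tsum_congr fun n => ?_
    rw [mul_assoc ((-1 : ℂ) ^ n), mul_assoc ((-1 : ℂ) ^ n), mul_left_comm (Complex.exp (π * t / 4)),
      ← Complex.exp_add, ← Complex.exp_add, ← Complex.exp_add]
    congr 2
    push_cast
    linear_combination (-π * (n - 1 / 2) ^ 2 * t : ℂ) * Complex.I_sq

/-- The Appell-type sum in the Mordell function, without its factor `q^(-1/8)`, tends to `0`. -/
theorem tendsto_mordell_sum :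
    Filter.Tendsto (fun t : ℝ => Complex.exp (-(π * t / 4)) *
      ∑' m : ℤ, Complex.exp (2 * π * I * ((m : ℂ)^2 / 2 - 1/8) * (t * I)) /
        (1 + Complex.exp (2 * π * I * ((m : ℂ) - 1/2) * (t * I)))) Filter.atTop (nhds 0) := by
  have key : ∀ (t : ℝ) (m : ℤ), Complex.exp (-(π * t / 4)) *
      (Complex.exp (2 * π * I * ((m : ℂ)^2 / 2 - 1/8) * (t * I)) /
        (1 + Complex.exp (2 * π * I * ((m : ℂ) - 1/2) * (t * I)))) =
      ((Real.exp (-(π * (m : ℝ) ^ 2 * t)) /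
        (1 + Real.exp (-(2 * π * (m - 1 / 2) * t))) : ℝ) : ℂ) := by
    intro t m
    push_cast
    rw [← mul_div_assoc, ← Complex.exp_add]
    congr 2
    · linear_combination (π * t * (m ^ 2 - 1 / 4) : ℂ) * Complex.I_sq
    · congr 1
      linear_combination (2 * π * t * (m - 1 / 2) : ℂ) * Complex.I_sq
  simp only [← tsum_mul_left, key]
  rw [← tsum_zero (α := ℂ) (β := ℤ)]
  refine tendsto_tsum_of_dominated_convergence (summable_norm_gaussian 0) (fun m => ?_) ?_
  · rw [← Complex.ofReal_zero]
    refine (Complex.continuous_ofReal.tendsto 0).comp ?_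
    by_cases hm : m = 0
    · have h : Filter.Tendsto (fun t : ℝ => (1 + Real.exp (π * t))⁻¹) Filter.atTop (nhds 0) :=
        (Filter.tendsto_atTop_add_const_left _ _ (Real.tendsto_exp_atTop.comp
          (Filter.tendsto_id.const_mul_atTop Real.pi_pos))).inv_tendsto_atTop
      refine h.congr fun t => ?_
      subst hm
      have h0 : -(2 * π * (((0 : ℤ) : ℝ) - 1 / 2) * t) = π * t := by
        push_cast
        ring
      rw [h0]
      simp
    · have h : Filter.Tendsto (fun t : ℝ => Real.exp (-(π * (m : ℝ) ^ 2 * t))) Filter.atTop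
          (nhds 0) :=
        Real.tendsto_exp_neg_atTop_nhds_zero.comp
          (Filter.tendsto_id.const_mul_atTop (by positivity))
      refine squeeze_zero (fun t => by positivity) (fun t => ?_) h
      exact div_le_self (Real.exp_pos _).le (by linarith [Real.exp_pos (-(2 * π * (m - 1 / 2) * t))])
  · filter_upwards [Filter.eventually_ge_atTop 1] with t ht m
    rw [mul_zero, Complex.exp_zero, one_mul, ← Complex.ofReal_neg, Complex.norm_exp_ofReal,
      Complex.norm_real, Real.norm_of_nonneg (by positivity)]
    refine (div_le_self (Real.exp_pos _).le
      (by linarith [Real.exp_pos (-(2 * π * (m - 1 / 2) * t))])).trans ?_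
    refine Real.exp_le_exp.2 (neg_le_neg ?_)
    exact le_mul_of_one_le_right (by positivity) ht

/-- `η(it) / q^(1/24)` tends to `1`. -/
theorem tendsto_dedekindEta_normalized :
    Filter.Tendsto (fun t : ℝ => Complex.exp (π * t / 12) * dedekindEta (t * I)) Filter.atTop
      (nhds 1) := by
  have hr : Filter.Tendsto (fun t : ℝ => Real.exp (-(2 * π * t))) Filter.atTop (nhds 0) :=
    Real.tendsto_exp_neg_atTop_nhds_zero.comp
      (Filter.tendsto_id.const_mul_atTop (by positivity))
  have hq : ∀ t : ℝ, Complex.exp (2 * π * I * (t * I)) = (Real.exp (-(2 * π * t)) : ℝ) := by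
    intro t
    push_cast
    congr 1
    linear_combination (2 * π * t : ℂ) * Complex.I_sq
  have h : Filter.Tendsto (fun t : ℝ =>
        ∏' n : ℕ, (1 + -((Real.exp (-(2 * π * t)) : ℝ) : ℂ) ^ (n + 1)))
      Filter.atTop (nhds (∏' _ : ℕ, (1 + (0 : ℂ)))) := by
    refine tendsto_tprod_one_add_of_dominated_convergence
      (bound := fun n : ℕ => (1 / 2 : ℝ) ^ (n + 1))
      ?_ (fun n => ?_) ?_
    · exact (summable_nat_add_iff 1).2 summable_geometric_two
    · have h' := ((Complex.continuous_ofReal.tendsto 0).comp hr).pow (n + 1)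
      simpa using h'.neg
    · filter_upwards [hr.eventually_le_const (show (0 : ℝ) < 1 / 2 by norm_num)] with t ht n
      rw [norm_neg, norm_pow, Complex.norm_real, Real.norm_of_nonneg (Real.exp_pos _).le]
      gcongr
  simp only [add_zero, tprod_one] at h
  refine h.congr fun t => ?_
  rw [dedekindEta, ← mul_assoc, ← Complex.exp_add, hq]
  have : (π * t / 12 + 2 * π * I * (t * I) / 24 : ℂ) = 0 := by
    linear_combination (π * t / 12 : ℂ) * Complex.I_sq
  rw [this, Complex.exp_zero, one_mul]
  simp only [sub_eq_add_neg]

theorem chi0_eq_normalized (t : ℝ) (z : ℂ) :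
    chi0 (t * I) z = -2 * (theta3 (t * I) z / theta3 (t * I) 0) ^ 2 +
      (1 / (Complex.exp (π * t / 12) * dedekindEta (t * I)) -
        2 * (1 / (Complex.exp (π * t / 12) * dedekindEta (t * I) * theta3 (t * I) 0) *
          (Complex.exp (-(π * t / 4)) *
            ∑' m : ℤ, Complex.exp (2 * π * I * ((m : ℂ)^2 / 2 - 1/8) * (t * I)) /
              (1 + Complex.exp (2 * π * I * ((m : ℂ) - 1/2) * (t * I)))))) *
      (Complex.exp (π * t / 4) * theta1 (t * I) z /
        (Complex.exp (π * t / 12) * dedekindEta (t * I))) ^ 2 := by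
  have h1 : Complex.exp (2 * π * I * (-1/8 : ℂ) * (t * I)) = Complex.exp (π * t / 12) ^ 3 := by
    rw [← Complex.exp_nat_mul]
    congr 1
    push_cast
    linear_combination (-π * t / 4 : ℂ) * Complex.I_sq
  have h2 : Complex.exp (π * t / 4) = Complex.exp (π * t / 12) ^ 3 := by
    rw [← Complex.exp_nat_mul]
    congr 1
    push_cast
    ring
  rw [chi0, mordellH3, h1, Complex.exp_neg, h2]
  generalize (∑' m : ℤ, Complex.exp (2 * π * I * ((m : ℂ)^2 / 2 - 1/8) * (t * I)) /
    (1 + Complex.exp (2 * π * I * ((m : ℂ) - 1/2) * (t * I)))) = S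
  field_simp

/-- For every `z ∈ ℂ`, the `N=4` vacuum character at central charge 6 has
leading order term `-y - y⁻¹`: `lim_{t → ∞} χ₀(it, z) = -exp(2πiz) - exp(-2πiz)` along
the positive imaginary axis `τ = it`. -/
theorem chi0_leading_order (z : ℂ) :
    Filter.Tendsto (fun t : ℝ => chi0 ((t : ℂ) * I) z) Filter.atTop
      (nhds (-Complex.exp (2 * π * I * z) - Complex.exp (-(2 * π * I * z)))) := by
  have h3z := tendsto_theta3 z
  have h30 := tendsto_theta3 0
  have heta := tendsto_dedekindEta_normalized
  have h := (((h3z.div h30 one_ne_zero).pow 2).const_mul (-2)).add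
    (((tendsto_const_nhds (x := (1 : ℂ)).div heta one_ne_zero).sub
      (((tendsto_const_nhds (x := (1 : ℂ)).div (heta.mul h30) (by norm_num)).mul
        tendsto_mordell_sum).const_mul 2)).mul
      (((tendsto_theta1_normalized z).div heta one_ne_zero).pow 2))
  convert h.congr fun t => (chi0_eq_normalized t z).symm using 2
  have e1 : Complex.exp (2 * π * I * z) = Complex.exp (π * I * z) ^ 2 := by
    rw [← Complex.exp_nat_mul]
    congr 1
    push_cast
    ring
  have e2 : Complex.exp (-(2 * π * I * z)) = Complex.exp (-(π * I * z)) ^ 2 := by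
    rw [← Complex.exp_nat_mul]
    congr 1
    push_cast
    ring
  have e3 : Complex.exp (π * I * z) * Complex.exp (-(π * I * z)) = 1 := by
    rw [← Complex.exp_add, add_neg_cancel, Complex.exp_zero]
  rw [e1, e2]
  linear_combination -2 * e3 -
    (Complex.exp (-(π * I * z)) - Complex.exp (π * I * z)) ^ 2 * Complex.I_sq
end

section
/- Let Λ ⊆ ℝ^n be a full-rank ℤ-lattice (a discrete additive subgroup spanning ℝ^n), let Λ* = { μ ∈ ℝ^n : ⟨μ, λ⟩ ∈ ℤ for all λ ∈ Λ } be its dual lattice, and let B : ℝ^n → ℝ^n be a linear map that is skew-symmetric with respect to the standard inner product (⟨Bx, y⟩ = −⟨x, By⟩ for all x, y). Then the set { t ∈ ℝ : t > 0 and there exists λ ∈ Λ, λ ≠ 0, with t²·(Bλ + λ) ∈ Λ* } is countable; in particular its complement in (0,∞) is dense. -/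
open scoped RealInnerProductSpace

/-- Let `Λ ⊆ ℝⁿ` be a full-rank ℤ-lattice, `Λ*` its dual lattice, and
`B : ℝⁿ → ℝⁿ` linear and skew-symmetric for the standard inner product. Then the set
`{t > 0 : ∃ λ ∈ Λ, λ ≠ 0, t²(Bλ + λ) ∈ Λ*}` is countable; in particular its complement
in `(0,∞)` is dense in `(0,∞)`. -/
theorem generic_volume_countable (n : ℕ)
    (Λ : AddSubgroup (EuclideanSpace ℝ (Fin n)))
    (hdisc : DiscreteTopology Λ)
    (hspan : Submodule.span ℝ (Λ : Set (EuclideanSpace ℝ (Fin n))) = ⊤)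
    (B : EuclideanSpace ℝ (Fin n) →ₗ[ℝ] EuclideanSpace ℝ (Fin n))
    (hB : ∀ x y : EuclideanSpace ℝ (Fin n), ⟪B x, y⟫ = -⟪x, B y⟫) :
    Set.Countable {t : ℝ | 0 < t ∧ ∃ l ∈ Λ, l ≠ 0 ∧
      ∀ m ∈ Λ, ∃ k : ℤ, ⟪t ^ 2 • (B l + l), m⟫ = (k : ℝ)} ∧
    Set.Ioi (0 : ℝ) ⊆ closure (Set.Ioi (0 : ℝ) \ {t : ℝ | 0 < t ∧ ∃ l ∈ Λ, l ≠ 0 ∧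
      ∀ m ∈ Λ, ∃ k : ℤ, ⟪t ^ 2 • (B l + l), m⟫ = (k : ℝ)}) := by
  have hcount : Set.Countable {t : ℝ | 0 < t ∧ ∃ l ∈ Λ, l ≠ 0 ∧
      ∀ m ∈ Λ, ∃ k : ℤ, ⟪t ^ 2 • (B l + l), m⟫ = (k : ℝ)} := by
    have : Countable Λ := TopologicalSpace.separableSpace_iff_countable.mp inferInstance
    refine (Set.countable_range fun p : Λ × ℤ =>
      √((p.2 : ℝ) / ‖(p.1 : EuclideanSpace ℝ (Fin n))‖ ^ 2)).mono ?_
    rintro t ⟨ht, l, hl, hl0, hdual⟩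
    obtain ⟨k, hk⟩ := hdual l hl
    refine ⟨(⟨l, hl⟩, k), ?_⟩
    have hnorm : ‖l‖ ^ 2 ≠ 0 := pow_ne_zero 2 (norm_ne_zero_iff.mpr hl0)
    have hself : ⟪B l, l⟫ = 0 := by
      linarith [hB l l, real_inner_comm (B l) l]
    rw [real_inner_smul_left, inner_add_left, hself, zero_add,
      real_inner_self_eq_norm_sq] at hk
    change √((k : ℝ) / ‖l‖ ^ 2) = t
    rw [← hk, mul_div_cancel_right₀ _ hnorm, Real.sqrt_sq ht.le]
  exact ⟨hcount, (hcount.dense_compl ℝ).open_subset_closure_inter isOpen_Ioi⟩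
end
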